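/- Let {x_k}_{k=1}^m be a frame for ℝⁿ. The following are equivalent: (1) {x_k}_{k=1}^m is injective; (2) the family {x̃_k}_{k=1}^m spans ℝ^{n(n+1)/2}. -/

import Mathlib

open scoped InnerProductSpace

/-- For `x ∈ ℝⁿ`, the vector `x̃ ∈ ℝ^{n(n+1)/2}`, whose entries are the products
`x_i x_j` for `i ≤ j`, realized as a function on the pairs `(i, j)` with `i ≤ j`. -/
def tildeVecR {n : ℕ} (x : EuclideanSpace ℝ (Fin n)) :
    {p : Fin n × Fin n // p.1 ≤ p.2} → ℝ :=
  fun p => x p.1.1 * x p.1.2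

theorem aux_inner {n : ℕ} (S : Matrix (Fin n) (Fin n) ℝ) (v : EuclideanSpace ℝ (Fin n)) :
    ⟪Matrix.toEuclideanCLM (𝕜 := ℝ) S v, v⟫_ℝ = ∑ i, ∑ j, S i j * (v i * v j) := by
  rw [PiLp.inner_apply]
  refine Finset.sum_congr rfl fun i _ => ?_
  rw [Matrix.ofLp_toEuclideanCLM]
  simp only [Matrix.mulVec, dotProduct, RCLike.inner_apply, conj_trivial, Finset.mul_sum]
  refine Finset.sum_congr rfl fun j _ => ?_
  ring

theorem aux_sum {n : ℕ} (g : {p : Fin n × Fin n // p.1 ≤ p.2} → ℝ) :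
    ∑ i, ∑ j, (if h : i ≤ j then g ⟨(i, j), h⟩ else 0) = ∑ p, g p := by
  classical
  rw [← Fintype.sum_prod_type' (f := fun i j => if h : i ≤ j then g ⟨(i, j), h⟩ else 0)]
  rw [← Finset.sum_filter_of_ne (p := fun p : Fin n × Fin n => p.1 ≤ p.2)]
  · rw [Finset.sum_subtype (p := fun p : Fin n × Fin n => p.1 ≤ p.2) _ (by simp)]
    refine Finset.sum_congr rfl fun p _ => ?_
    rw [dif_pos p.2]
  · intro p _ hp
    by_contra hc
    exact hp (dif_neg hc)

/-- A frame `{x_k}_{k=1}^m` for `ℝⁿ` is injective if and only if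
the family `{x̃_k}_{k=1}^m` spans `ℝ^{n(n+1)/2}`. -/
theorem stmt_1 {n m : ℕ} (x : Fin m → EuclideanSpace ℝ (Fin n))
    (hframe : ∃ A B : ℝ, 0 < A ∧ A ≤ B ∧ ∀ v : EuclideanSpace ℝ (Fin n),
      A * ‖v‖ ^ 2 ≤ ∑ k, ⟪v, x k⟫_ℝ ^ 2 ∧ ∑ k, ⟪v, x k⟫_ℝ ^ 2 ≤ B * ‖v‖ ^ 2) :
    ((∀ T : EuclideanSpace ℝ (Fin n) →L[ℝ] EuclideanSpace ℝ (Fin n),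
        IsSelfAdjoint T → (∀ k, ⟪T (x k), x k⟫_ℝ = 0) → T = 0) ↔
      Submodule.span ℝ (Set.range fun k => tildeVecR (x k)) = ⊤) := by
  constructor
  · intro hinj
    by_contra hne
    obtain ⟨f, hf0, hf⟩ := Submodule.exists_le_ker_of_lt_top _ (lt_top_iff_ne_top.mpr hne)
    classical
    set c : {p : Fin n × Fin n // p.1 ≤ p.2} → ℝ := fun p => f (Pi.single p 1) with hc
    have hfc : ∀ y, f y = ∑ p, c p * y p := by
      intro y
      rw [LinearMap.pi_apply_eq_sum_univ f y]
      refine Finset.sum_congr rfl fun p _ => ?_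
      rw [smul_eq_mul, mul_comm]
      congr 2
      ext q
      simp [Pi.single_apply, eq_comm]
    set M : Matrix (Fin n) (Fin n) ℝ :=
      Matrix.of fun i j => if h : i ≤ j then c ⟨(i, j), h⟩ else 0 with hM
    have hMq : ∀ v : EuclideanSpace ℝ (Fin n),
        ∑ i, ∑ j, M i j * (v i * v j) = f (tildeVecR v) := by
      intro v
      rw [hfc, ← aux_sum]
      refine Finset.sum_congr rfl fun i _ => Finset.sum_congr rfl fun j _ => ?_
      simp only [hM, Matrix.of_apply, tildeVecR]
      split_ifs <;> simp
    have hS : IsSelfAdjoint (M + M.transpose) := by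
      change star _ = _
      rw [Matrix.star_eq_conjTranspose, Matrix.conjTranspose_eq_transpose_of_trivial,
        Matrix.transpose_add, Matrix.transpose_transpose, add_comm]
    have hT := hinj (Matrix.toEuclideanCLM (𝕜 := ℝ) (M + M.transpose)) (hS.map _) (by
      intro k
      have h0 : f (tildeVecR (x k)) = 0 := hf (Submodule.subset_span ⟨k, rfl⟩)
      rw [aux_inner]
      simp only [Matrix.add_apply, Matrix.transpose_apply, add_mul, Finset.sum_add_distrib]
      rw [hMq, Finset.sum_comm]
      simp only [mul_comm ((x k) _) ((x k) _)]
      have := hMq (x k)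
      simp only [mul_comm ((x k) _) ((x k) _)] at this
      rw [this, h0, add_zero])
    have hS0 : M + M.transpose = 0 := by
      exact (EmbeddingLike.map_eq_zero_iff (f := Matrix.toEuclideanCLM (𝕜 := ℝ) (n := Fin n))).mp hT
    apply hf0
    ext1 p
    ext
    obtain ⟨⟨i, j⟩, hij⟩ := p
    have e := congrFun (congrFun hS0 i) j
    have hij' : i ≤ j := hij
    simp only [hM, Matrix.add_apply, Matrix.transpose_apply, Matrix.of_apply, dif_pos hij',
      Matrix.zero_apply] at e
    have : c ⟨(i, j), hij⟩ = 0 := by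
      rcases eq_or_lt_of_le hij' with h | h
      · subst h
        simp only [le_refl, dif_pos] at e
        linarith
      · rw [dif_neg (not_le.mpr h), add_zero] at e
        exact e
    simpa [hc] using this
  · intro hspan T hT hk
    obtain ⟨S, rfl⟩ := (Matrix.toEuclideanCLM (𝕜 := ℝ) (n := Fin n)).surjective T
    let φ : ({p : Fin n × Fin n // p.1 ≤ p.2} → ℝ) →ₗ[ℝ] ℝ :=
      ∑ i, ∑ j, S i j • LinearMap.proj (⟨(min i j, max i j), min_le_max⟩ :
        {p : Fin n × Fin n // p.1 ≤ p.2})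
    have hφ : ∀ v : EuclideanSpace ℝ (Fin n),
        φ (tildeVecR v) = ⟪Matrix.toEuclideanCLM (𝕜 := ℝ) S v, v⟫_ℝ := by
      intro v
      rw [aux_inner]
      simp only [φ, LinearMap.sum_apply, LinearMap.smul_apply, LinearMap.proj_apply, tildeVecR,
        smul_eq_mul]
      refine Finset.sum_congr rfl fun i _ => Finset.sum_congr rfl fun j _ => ?_
      rcases le_total i j with h | h
      · simp [h]
      · simp [h, mul_comm]
    have h0 : φ = 0 := by
      apply LinearMap.ext_on_range hspan
      intro k
      rw [hφ, LinearMap.zero_apply]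
      exact hk k
    have hsym := (ContinuousLinearMap.isSelfAdjoint_iff_isSymmetric.mp hT)
    have := hsym.inner_map_self_eq_zero.mp (fun v => by
      have := hφ v
      rw [h0, LinearMap.zero_apply] at this
      exact this.symm)
    ext1 v
    exact LinearMap.congr_fun this v
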